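/- Let T > 0 and x ∈ ℝ. Let Z be a standard Gaussian random variable and U an Exp(1)-distributed random variable, independent of Z. Then E[ |x + √(T·U) · Z| ] = |x| + √(T/2) · exp( −√(2/T) · |x| ). Equivalently, ∫₀^∞ ( ∫_ℝ |x + √(T u) z| dN(0,1)(z) ) e^{−u} du = |x| + √(T/2) e^{−√(2/T)|x|}. -/

import Mathlib

open MeasureTheory Real ProbabilityTheory

lemma aux_expMeasure_eq {r : ℝ} :
    expMeasure r = (volume.restrict (Set.Ioi (0:ℝ))).withDensity
      (fun y => ENNReal.ofReal (r * Real.exp (-(r * y)))) := by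
  have h1 : expMeasure r = volume.withDensity
      ((Set.Ici (0:ℝ)).indicator (fun y => ENNReal.ofReal (r * Real.exp (-(r * y))))) := by
    unfold expMeasure gammaMeasure
    congr 1
    ext y
    have := exponentialPDF_eq r y
    unfold exponentialPDF exponentialPDFReal at this
    rw [gammaPDF, this, Set.indicator_apply]
    simp only [Set.mem_Ici]
    split_ifs <;> simp
  rw [h1, withDensity_indicator measurableSet_Ici, restrict_Ioi_eq_restrict_Ici]

lemma aux_integral_exp {E : Type*} [NormedAddCommGroup E] [NormedSpace ℝ E] {r : ℝ} (hr : 0 < r)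
    (f : ℝ → E) :
    ∫ y, f y ∂(expMeasure r) = ∫ y in Set.Ioi (0:ℝ), (r * Real.exp (-(r * y))) • f y := by
  rw [aux_expMeasure_eq, integral_withDensity_eq_integral_toReal_smul (by fun_prop) (by simp)]
  refine integral_congr_ae (Filter.Eventually.of_forall fun y => ?_)
  simp only
  rw [ENNReal.toReal_ofReal (by positivity)]

lemma aux_integrable_exp {r : ℝ} (hr : 0 < r) (f : ℝ → ℝ)
    (h : IntegrableOn (fun y => (r * Real.exp (-(r * y))) * f y) (Set.Ioi 0)) :
    Integrable f (expMeasure r) := by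
  rw [aux_expMeasure_eq, integrable_withDensity_iff_integrable_smul' (by fun_prop) (by simp)]
  refine h.congr (Filter.Eventually.of_forall fun y => ?_)
  simp only [smul_eq_mul]
  rw [ENNReal.toReal_ofReal (by positivity)]

lemma aux_cexp {r : ℝ} (hr : 0 < r) (c : ℂ) (hc : c.re < r) :
    ∫ y, Complex.exp (c * y) ∂(expMeasure r) = r / (r - c) := by
  rw [aux_integral_exp hr]
  have h : ∀ y : ℝ, (r * Real.exp (-(r * y))) • Complex.exp (c * y)
      = r * Complex.exp ((c - r) * y) := by
    intro y
    rw [Complex.real_smul]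
    push_cast
    rw [mul_assoc, ← Complex.exp_add]
    ring_nf
  simp_rw [h]
  rw [integral_const_mul, integral_exp_mul_complex_Ioi (by simpa using hc)]
  simp only [Complex.ofReal_zero, mul_zero, Complex.exp_zero]
  rw [neg_div, ← div_neg, neg_sub, mul_one_div]

lemma aux_deriv (r y : ℝ) (hr : 0 < r) :
    HasDerivAt (fun y => -(y * Real.exp (-(r * y))) - Real.exp (-(r * y)) / r)
      ((r * Real.exp (-(r * y))) * y) y := by
  have h1 : HasDerivAt (fun y => Real.exp (-(r * y))) (Real.exp (-(r * y)) * (-(r * 1))) y :=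
    (((hasDerivAt_id y).const_mul r).neg).exp
  have h2 := (((hasDerivAt_id y).mul h1).neg).sub (h1.div_const r)
  refine h2.congr_deriv ?_
  simp only [id]
  field_simp
  ring

lemma aux_tendsto (r : ℝ) (hr : 0 < r) :
    Filter.Tendsto (fun y => -(y * Real.exp (-(r * y))) - Real.exp (-(r * y)) / r)
      Filter.atTop (nhds 0) := by
  have h1 := tendsto_rpow_mul_exp_neg_mul_atTop_nhds_zero 1 r hr
  have h0 := tendsto_rpow_mul_exp_neg_mul_atTop_nhds_zero 0 r hr
  have := h1.neg.sub (h0.div_const r)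
  simpa using this

lemma aux_int_y (r a : ℝ) (hr : 0 < r) (ha : 0 ≤ a) :
    IntegrableOn (fun y => (r * Real.exp (-(r * y))) * y) (Set.Ioi a) ∧
    ∫ y in Set.Ioi a, (r * Real.exp (-(r * y))) * y
      = a * Real.exp (-(r * a)) + Real.exp (-(r * a)) / r := by
  constructor
  · refine integrableOn_Ioi_deriv_of_nonneg' (fun y _ => aux_deriv r y hr) ?_ (aux_tendsto r hr)
    intro y hy
    have : 0 ≤ y := ha.trans (le_of_lt hy)
    positivity
  · rw [integral_Ioi_of_hasDerivAt_of_nonneg' (fun y _ => aux_deriv r y hr) ?_ (aux_tendsto r hr)]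
    · ring
    · intro y hy
      have : 0 ≤ y := ha.trans (le_of_lt hy)
      positivity

lemma aux_int_e (r : ℝ) (hr : 0 < r) :
    IntegrableOn (fun y => r * Real.exp (-(r * y))) (Set.Ioi 0) := by
  simp only [neg_mul_eq_neg_mul]
  exact (exp_neg_integrableOn_Ioi _ hr).const_mul r

lemma aux_int_abs (r x s : ℝ) (hr : 0 < r) :
    IntegrableOn (fun y => (r * Real.exp (-(r * y))) * |x + s * y|) (Set.Ioi 0) := by
  have h := (((aux_int_e r hr).mul_const x).add ((aux_int_y r 0 hr le_rfl).1.const_mul s)).abs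
  refine h.congr (Filter.Eventually.of_forall fun y => ?_)
  simp only [Pi.add_apply]
  rw [show r * Real.exp (-(r * y)) * x + s * (r * Real.exp (-(r * y)) * y)
    = (r * Real.exp (-(r * y))) * (x + s * y) by ring, abs_mul, abs_of_nonneg (by positivity)]

lemma aux_max (r a : ℝ) (hr : 0 < r) (ha : 0 ≤ a) :
    ∫ y in Set.Ioi (0:ℝ), (r * Real.exp (-(r * y))) * max a y = a + Real.exp (-(r * a)) / r := by
  have e1 : Set.EqOn (fun y => (r * Real.exp (-(r * y))) * max a y)
      (fun y => (r * Real.exp (-(r * y))) * a) (Set.Ioc 0 a) := by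
    intro y hy
    simp only
    rw [max_eq_left hy.2]
  have e2 : Set.EqOn (fun y => (r * Real.exp (-(r * y))) * max a y)
      (fun y => (r * Real.exp (-(r * y))) * y) (Set.Ioi a) := by
    intro y hy
    simp only
    rw [max_eq_right (le_of_lt hy)]
  have i1 : IntegrableOn (fun y => (r * Real.exp (-(r * y))) * a) (Set.Ioc 0 a) :=
    ((aux_int_e r hr).mono_set Set.Ioc_subset_Ioi_self).mul_const a
  rw [← Set.Ioc_union_Ioi_eq_Ioi ha, setIntegral_union (Set.Ioc_disjoint_Ioi le_rfl)
    measurableSet_Ioi (i1.congr_fun e1.symm measurableSet_Ioc)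
    ((aux_int_y r a hr ha).1.congr_fun e2.symm measurableSet_Ioi),
    setIntegral_congr_fun measurableSet_Ioc e1, setIntegral_congr_fun measurableSet_Ioi e2,
    (aux_int_y r a hr ha).2, integral_mul_const, ← intervalIntegral.integral_of_le ha,
    intervalIntegral.integral_eq_sub_of_hasDerivAt (f := fun y => -Real.exp (-(r * y)))
      (fun y _ => hasDerivAt_neg_exp_mul_exp) (Continuous.intervalIntegrable (by fun_prop) _ _)]
  simp
  ring

/-- The Laplace distribution with rate `r`. -/
noncomputable def auxLaplace (r : ℝ) : Measure ℝ :=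
  (2⁻¹ : NNReal) • (expMeasure r) + (2⁻¹ : NNReal) • ((expMeasure r).map (fun y => (-1) * y))

lemma aux_laplace_charFun (r t : ℝ) (hr : 0 < r) :
    charFun (auxLaplace r) t = (r ^ 2 / (r ^ 2 + t ^ 2) : ℝ) := by
  have := isProbabilityMeasure_expMeasure hr
  have key : ∀ s : ℝ, charFun (expMeasure r) s = r / (r - s * Complex.I) := by
    intro s
    rw [charFun_apply_real, ← aux_cexp hr (s * Complex.I) (by simpa using hr)]
    congr 1
    ext y
    ring_nf
  have hi : ∀ μ : Measure ℝ, IsProbabilityMeasure μ →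
      Integrable (fun x : ℝ => Complex.exp (t * x * Complex.I)) μ := by
    intro μ hμ
    refine Integrable.of_bound (by fun_prop) 1 (Filter.Eventually.of_forall fun x => ?_)
    rw [← Complex.ofReal_mul, Complex.norm_exp_ofReal_mul_I]
  have hm : IsProbabilityMeasure ((expMeasure r).map (fun y => (-1) * y)) :=
    Measure.isProbabilityMeasure_map (by fun_prop)
  rw [charFun_apply_real, auxLaplace, integral_add_measure
    ((hi _ inferInstance).smul_measure_nnreal) ((hi _ inferInstance).smul_measure_nnreal),
    integral_smul_nnreal_measure, integral_smul_nnreal_measure, ← charFun_apply_real,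
    ← charFun_apply_real, charFun_map_mul, key, key]
  have n1 : (r : ℂ) - t * Complex.I ≠ 0 := by
    intro h; have := congrArg Complex.re h; simp at this; linarith
  have n2 : (r : ℂ) + t * Complex.I ≠ 0 := by
    intro h; have := congrArg Complex.re h; simp at this; linarith
  have n3 : (r : ℂ) ^ 2 + t ^ 2 = (r - t * Complex.I) * (r + t * Complex.I) := by
    ring_nf; simp
  simp only [NNReal.smul_def, Complex.real_smul]
  push_cast
  rw [n3, show (r : ℂ) - -1 * t * Complex.I = r + t * Complex.I by ring]
  field_simp
  ring

lemma aux_laplace_abs (r x : ℝ) (hr : 0 < r) :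
    ∫ y, |x + y| ∂(auxLaplace r) = |x| + Real.exp (-(r * |x|)) / r := by
  have i1 : Integrable (fun y => |x + y|) (expMeasure r) :=
    aux_integrable_exp hr _ (by simpa using aux_int_abs r x 1 hr)
  have i2 : Integrable (fun y => |x + y|) ((expMeasure r).map (fun y => (-1) * y)) := by
    rw [integrable_map_measure (by fun_prop) (by fun_prop)]
    exact aux_integrable_exp hr _ (aux_int_abs r x (-1) hr)
  rw [auxLaplace, integral_add_measure i1.smul_measure_nnreal i2.smul_measure_nnreal,
    integral_smul_nnreal_measure, integral_smul_nnreal_measure,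
    integral_map (by fun_prop) (by fun_prop), aux_integral_exp hr, aux_integral_exp hr,
    ← smul_add, ← aux_max r |x| hr (abs_nonneg x)]
  simp only [smul_eq_mul]
  rw [← integral_add (by simpa [IntegrableOn] using aux_int_abs r x 1 hr) (aux_int_abs r x (-1) hr),
    NNReal.smul_def, smul_eq_mul, ← integral_const_mul]
  refine setIntegral_congr_fun measurableSet_Ioi fun y hy => ?_
  have hy : 0 < y := hy
  have : |x + y| + |x + -1 * y| = 2 * max |x| y := by
    rcases abs_cases x with h | h <;> rcases abs_cases (x + y) with h1 | h1 <;>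
      rcases abs_cases (x + -1 * y) with h2 | h2 <;> rcases max_cases |x| y with h3 | h3 <;>
      linarith
  simp only [← mul_add, this]
  push_cast
  ring

lemma aux_map_U {Ω : Type*} [MeasurableSpace Ω] (P : Measure Ω) [IsProbabilityMeasure P]
    (U : Ω → ℝ) (hUmeas : Measurable U)
    (hUexp : ∀ u : ℝ, 0 ≤ u → P {ω | u < U ω} = ENNReal.ofReal (Real.exp (-u))) :
    P.map U = expMeasure 1 := by
  have := isProbabilityMeasure_expMeasure (r := 1) one_pos
  have hm : IsProbabilityMeasure (P.map U) := Measure.isProbabilityMeasure_map (by fun_prop)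
  have key : ∀ u, 0 ≤ u → (P.map U).real (Set.Iic u) = 1 - Real.exp (-u) := by
    intro u hu
    have h1 : (P.map U).real (Set.Iic u)ᶜ = Real.exp (-u) := by
      rw [Set.compl_Iic, measureReal_def, Measure.map_apply hUmeas measurableSet_Ioi]
      have := hUexp u hu
      rw [show U ⁻¹' Set.Ioi u = {ω | u < U ω} from rfl, this,
        ENNReal.toReal_ofReal (by positivity)]
    rw [probReal_compl_eq_one_sub measurableSet_Iic] at h1
    linarith
  apply Measure.eq_of_cdf
  ext u
  rw [cdf_expMeasure_eq one_pos, cdf_eq_real]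
  split_ifs with h
  · rw [key u h, one_mul]
  · have h0 := key 0 le_rfl
    have hle : (P.map U).real (Set.Iic u) ≤ (P.map U).real (Set.Iic 0) :=
      measureReal_mono (Set.Iic_subset_Iic.2 (not_le.1 h).le)
    simp only [neg_zero, Real.exp_zero, sub_self] at h0
    exact le_antisymm (hle.trans h0.le) measureReal_nonneg

lemma aux_law {Ω : Type*} [MeasurableSpace Ω] (P : Measure Ω) [IsProbabilityMeasure P]
    (T : ℝ) (hT : 0 < T)
    (Z U : Ω → ℝ) (hZmeas : Measurable Z) (hUmeas : Measurable U)
    (hZ : Measure.map Z P = gaussianReal 0 1)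
    (hU : P.map U = expMeasure 1)
    (hindep : IndepFun Z U P) :
    P.map (fun ω => Real.sqrt (T * U ω) * Z ω) = auxLaplace (Real.sqrt (2 / T)) := by
  have := isProbabilityMeasure_expMeasure (r := 1) one_pos
  have hr : 0 < Real.sqrt (2 / T) := by positivity
  have := isProbabilityMeasure_expMeasure hr
  have hm : IsProbabilityMeasure ((expMeasure (Real.sqrt (2 / T))).map (fun y => (-1) * y)) :=
    Measure.isProbabilityMeasure_map (by fun_prop)
  have hfin : IsFiniteMeasure (auxLaplace (Real.sqrt (2 / T))) := by
    unfold auxLaplace; infer_instance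
  have hfin2 : IsFiniteMeasure (P.map (fun ω => Real.sqrt (T * U ω) * Z ω)) := inferInstance
  apply Measure.ext_of_charFun
  ext t
  rw [aux_laplace_charFun _ _ hr, charFun_apply_real, integral_map (by fun_prop) (by fun_prop)]
  have hpair : P.map (fun ω => (U ω, Z ω)) = (expMeasure 1).prod (gaussianReal 0 1) := by
    rw [(indepFun_iff_map_prod_eq_prod_map_map hUmeas.aemeasurable hZmeas.aemeasurable).1
      hindep.symm, hU, hZ]
  have e1 : ∫ ω, Complex.exp (t * ((Real.sqrt (T * U ω) * Z ω : ℝ) : ℂ) * Complex.I) ∂P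
      = ∫ p : ℝ × ℝ, Complex.exp (t * ((Real.sqrt (T * p.1) * p.2 : ℝ) : ℂ) * Complex.I)
        ∂((expMeasure 1).prod (gaussianReal 0 1)) := by
    rw [← hpair, integral_map (by fun_prop) (by fun_prop)]
  rw [e1, integral_prod]
  · have e2 : ∀ u : ℝ, ∫ z, Complex.exp (t * ((Real.sqrt (T * u) * z : ℝ) : ℂ) * Complex.I)
        ∂(gaussianReal 0 1) = Complex.exp (-((t * Real.sqrt (T * u)) ^ 2 / 2 : ℝ)) := by
      intro u
      have := charFun_gaussianReal (μ := 0) (v := 1) (t * Real.sqrt (T * u))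
      rw [charFun_apply_real] at this
      convert! this using 2
      · ext z; push_cast; ring_nf
      · push_cast; ring_nf
    simp only [e2]
    have e3 : ∫ u, Complex.exp (-((t * Real.sqrt (T * u)) ^ 2 / 2 : ℝ)) ∂(expMeasure 1)
        = ∫ u, Complex.exp (((-(t ^ 2 * T / 2) : ℝ) : ℂ) * u) ∂(expMeasure 1) := by
      rw [aux_integral_exp one_pos, aux_integral_exp one_pos]
      refine setIntegral_congr_fun measurableSet_Ioi fun u hu => ?_
      have hu : 0 < u := hu
      rw [mul_pow, Real.sq_sqrt (by positivity)]
      push_cast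
      ring_nf
    rw [e3, aux_cexp one_pos _ (by rw [Complex.ofReal_re]; nlinarith [mul_nonneg (sq_nonneg t) hT.le]),
      Real.sq_sqrt (by positivity)]
    norm_cast
    have h0 : 0 ≤ t ^ 2 * T := by positivity
    have h1 : 1 - -(t ^ 2 * T / 2) ≠ 0 := by linarith
    have h2 : 2 / T + t ^ 2 ≠ 0 := by positivity
    rw [div_eq_div_iff h1 h2]
    field_simp
    ring
  · refine Integrable.of_bound (by fun_prop) 1 (Filter.Eventually.of_forall fun x => ?_)
    rw [← Complex.ofReal_mul, Complex.norm_exp_ofReal_mul_I]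

/-- Let T > 0 and x ∈ ℝ. Let Z be a standard Gaussian random
variable and U an Exp(1)-distributed random variable, independent of Z. Then
E[ |x + √(T·U) · Z| ] = |x| + √(T/2) · exp( −√(2/T) · |x| ). -/
theorem equilibrium_value_constant_rate_brownian_abs
    {Ω : Type*} [MeasurableSpace Ω] (P : Measure Ω) [IsProbabilityMeasure P]
    (T x : ℝ) (hT : 0 < T)
    (Z U : Ω → ℝ) (hZmeas : Measurable Z) (hUmeas : Measurable U)
    (hZ : Measure.map Z P = gaussianReal 0 1)
    (hUexp : ∀ u : ℝ, 0 ≤ u → P {ω | u < U ω} = ENNReal.ofReal (Real.exp (-u)))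
    (hindep : IndepFun Z U P) :
    ∫ ω, |x + Real.sqrt (T * U ω) * Z ω| ∂P
      = |x| + Real.sqrt (T / 2) * Real.exp (-(Real.sqrt (2 / T) * |x|)) := by
  have hU := aux_map_U P U hUmeas hUexp
  have hr : 0 < Real.sqrt (2 / T) := by positivity
  have h := aux_laplace_abs (Real.sqrt (2 / T)) x hr
  rw [← aux_law P T hT Z U hZmeas hUmeas hZ hU hindep,
    integral_map (by fun_prop) (by fun_prop)] at h
  rw [h, show T / 2 = (2 / T)⁻¹ by simp, Real.sqrt_inv]
  ring
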